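/- arXiv:1810.00481 — 2 statements merged into one kernel-verified Lean document; each statement's English description precedes it below -/
import Mathlib

section
/- Let k ≥ 2, r ≥ 1, and let f : 𝔽₂^r → {−1,1} be a k-Fourier-sparse Boolean function such that f̂(e_j) ≠ 0 for every j ∈ [r], where e_j is the j-th standard basis vector of 𝔽₂^r. Then 1 − f̂(0^r) ≥ r/(k·log₂ k). -/
/-- The Fourier coefficient of `f : 𝔽₂ⁿ → ℝ` at `S ∈ 𝔽₂ⁿ`. -/
noncomputable def fCoeff {n : ℕ} (f : (Fin n → ZMod 2) → ℝ) (S : Fin n → ZMod 2) : ℝ :=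
  (1 / 2 ^ n) * ∑ x : Fin n → ZMod 2, f x * (-1 : ℝ) ^ (∑ i, (S i).val * (x i).val)

/-- The Fourier support of `f`. -/
noncomputable def fSupp {n : ℕ} (f : (Fin n → ZMod 2) → ℝ) : Set (Fin n → ZMod 2) :=
  {S | fCoeff f S ≠ 0}

/-- The `j`-th standard basis vector of `𝔽₂ⁿ`. -/
def stdBasis {n : ℕ} (j : Fin n) : Fin n → ZMod 2 :=
  fun i => if i = j then 1 else 0

open Finset in
/-- If every set of size at most `s + t` has evenly many supersets in `𝒜`, then the members of `𝒜`
of size at most `s` and those of size at most `t` number at most `#𝒜` in total. -/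
theorem card_filter_add_card_filter_le {ι : Type*} [DecidableEq ι] (𝒜 : Finset (Finset ι))
    (s t : ℕ) (h : ∀ T : Finset ι, #T ≤ s + t → Even #{x ∈ 𝒜 | T ⊆ x}) :
    #{x ∈ 𝒜 | #x ≤ s} + #{x ∈ 𝒜 | #x ≤ t} ≤ #𝒜 := by
  classical
  let M : ℕ → Matrix {x // x ∈ 𝒜} {x // x ∈ 𝒜} (ZMod 2) :=
    fun u p x => if #p.1 ≤ u ∧ p.1 ⊆ x.1 then 1 else 0
  have hM (u p x) : M u p x = if #p.1 ≤ u ∧ p.1 ⊆ x.1 then 1 else 0 := rfl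
  have hrank (u : ℕ) : #{x ∈ 𝒜 | #x ≤ u} ≤ (M u).rank := by
    let P := {p : {x // x ∈ 𝒜} // #p.1 ≤ u}
    have hli : LinearIndependent (ZMod 2) (fun p : P => M u p.1) := by
      rw [Fintype.linearIndependent_iff]
      intro c hc
      by_contra! hne
      have hne' : (univ.filter fun p : P => c p ≠ 0).Nonempty := by
        obtain ⟨p, hp⟩ := hne
        exact ⟨p, by simpa using hp⟩
      obtain ⟨p, hp, hmin⟩ := exists_min_image _ (fun p : P => #p.1.1) hne'
      have hev := congrFun hc p.1
      rw [Finset.sum_apply, sum_eq_single p] at hev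
      · simp [M, p.2] at hev
        simp [hev] at hp
      · intro q _ hqp
        by_cases hq : c q = 0
        · simp [hq]
        · have hle := hmin q (by simpa using hq)
          have : ¬ q.1.1 ⊆ p.1.1 := fun hsub =>
            hqp (Subtype.ext (Subtype.ext (eq_of_subset_of_card_le hsub hle)))
          rw [Pi.smul_apply, hM, if_neg fun h => this h.2, smul_zero]
      · simp
    have hcard : Fintype.card P = #{x ∈ 𝒜 | #x ≤ u} := by
      rw [Fintype.card_subtype, ← card_map (Function.Embedding.subtype _)]
      congr 1
      ext x
      simp [and_comm]
    rw [← hcard, Matrix.rank_eq_finrank_span_row, ← finrank_span_eq_card hli]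
    refine Submodule.finrank_mono (Submodule.span_mono ?_)
    rintro _ ⟨p, rfl⟩
    exact ⟨p.1, rfl⟩
  have hmul : M s * (M t).transpose = 0 := by
    ext p q
    rw [Matrix.mul_apply]
    have hval : ∀ x : {x // x ∈ 𝒜}, M s p x * (M t).transpose x q
        = if #p.1 ≤ s ∧ #q.1 ≤ t ∧ p.1 ∪ q.1 ⊆ x.1 then 1 else 0 := by
      intro x
      rw [Matrix.transpose_apply, hM, hM, ite_zero_mul_ite_zero, mul_one]
      exact if_congr (by rw [union_subset_iff]; tauto) rfl rfl
    simp only [hval]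
    rw [sum_coe_sort 𝒜
      (fun x => if #p.1 ≤ s ∧ #q.1 ≤ t ∧ p.1 ∪ q.1 ⊆ x then (1 : ZMod 2) else 0), sum_boole]
    by_cases hpq : #p.1 ≤ s ∧ #q.1 ≤ t
    · have hev := h (p.1 ∪ q.1) ((card_union_le _ _).trans (by omega))
      simpa [hpq.1, hpq.2] using (ZMod.natCast_eq_zero_iff_even).2 hev
    · rw [filter_false_of_mem fun x _ hx => hpq ⟨hx.1, hx.2.1⟩]
      simp
  have := Matrix.rank_add_rank_le_card_of_mul_eq_zero hmul
  rw [Matrix.rank_transpose, Fintype.card_coe] at this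
  exact (add_le_add (hrank s) (hrank t)).trans this

open Finset in
theorem card_mul_le_two_mul_sum_card {ι : Type*} [DecidableEq ι] (𝒜 : Finset (Finset ι))
    (N : ℕ) (h : ∀ T : Finset ι, #T < N → Even #{x ∈ 𝒜 | T ⊆ x}) :
    N * #𝒜 ≤ 2 * ∑ x ∈ 𝒜, #x := by
  have hpair : ∀ t ∈ range N,
      #{x ∈ 𝒜 | #x ≤ t} + #{x ∈ 𝒜 | #x ≤ N - 1 - t} ≤ #𝒜 := fun t ht =>
    card_filter_add_card_filter_le 𝒜 _ _ fun T hT => h T (by simp at ht; omega)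
  have hsum := sum_le_sum hpair
  rw [sum_add_distrib, sum_range_reflect (fun t => #{x ∈ 𝒜 | #x ≤ t}) N, sum_const, card_range,
    smul_eq_mul] at hsum
  have hswap : N * #𝒜 ≤ ∑ t ∈ range N, #{x ∈ 𝒜 | #x ≤ t} + ∑ x ∈ 𝒜, #x := by
    simp only [card_filter]
    rw [sum_comm, ← sum_add_distrib, mul_comm, ← smul_eq_mul, ← sum_const]
    refine sum_le_sum fun x _ => ?_
    rw [← card_filter]
    have : range N ⊆ (range N).filter (fun t => #x ≤ t) ∪ range #x := by
      intro t ht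
      simp at ht ⊢
      omega
    simpa using (card_le_card this).trans (card_union_le _ _)
  omega

/-- The character of `𝔽₂ⁿ` indexed by `S`. -/
noncomputable def chi {n : ℕ} (S x : Fin n → ZMod 2) : ℝ :=
  (-1 : ℝ) ^ (∑ i, (S i).val * (x i).val)

section Characters

variable {n : ℕ}

theorem fCoeff_eq (f : (Fin n → ZMod 2) → ℝ) (S : Fin n → ZMod 2) :
    fCoeff f S = (1 / 2 ^ n) * ∑ x, f x * chi S x := rfl

theorem chi_comm (S x : Fin n → ZMod 2) : chi S x = chi x S := by
  simp only [chi, mul_comm]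

theorem chi_add (S x y : Fin n → ZMod 2) : chi S (x + y) = chi S x * chi S y := by
  simp only [chi, ← Finset.prod_pow_eq_pow_sum, ← Finset.prod_mul_distrib, Pi.add_apply]
  refine Finset.prod_congr rfl fun i _ => ?_
  have key : ∀ a b c : ZMod 2,
      (-1 : ℝ) ^ (a.val * (b + c).val) = (-1) ^ (a.val * b.val) * (-1) ^ (a.val * c.val) := by
    intro a b c
    rw [← pow_add, neg_one_pow_congr]
    revert a b c
    decide
  exact key _ _ _

theorem chi_add_left (S T x : Fin n → ZMod 2) : chi (S + T) x = chi S x * chi T x := by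
  rw [chi_comm, chi_add, chi_comm x S, chi_comm x T]

theorem chi_zero (S : Fin n → ZMod 2) : chi S 0 = 1 := by simp [chi]

theorem chi_zero_left (x : Fin n → ZMod 2) : chi 0 x = 1 := by simp [chi]

theorem chi_eq_or (S x : Fin n → ZMod 2) : chi S x = 1 ∨ chi S x = -1 :=
  neg_one_pow_eq_or ℝ _

theorem chi_stdBasis (j : Fin n) (x : Fin n → ZMod 2) :
    chi (stdBasis j) x = if x j = 0 then 1 else -1 := by
  have hs : ∑ i, (stdBasis j i).val * (x i).val = (x j).val := by
    rw [Finset.sum_eq_single j]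
    · simp [stdBasis, ZMod.val_one]
    · intro i _ hij
      simp [stdBasis, hij]
    · simp
  rw [chi, hs]
  have hcases : ∀ a : ZMod 2, a = 0 ∨ a = 1 := by decide
  rcases hcases (x j) with h | h <;> simp [h, ZMod.val_one]

theorem add_self_zmodTwo (x : Fin n → ZMod 2) : x + x = 0 := by
  funext i
  exact CharTwo.add_self_eq_zero _

theorem exists_chi_stdBasis_eq_neg_one {x : Fin n → ZMod 2} (hx : x ≠ 0) :
    ∃ j, chi (stdBasis j) x = -1 := by
  obtain ⟨j, hj⟩ := Function.ne_iff.1 hx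
  exact ⟨j, by rw [chi_stdBasis, if_neg (by simpa using hj)]⟩

theorem sum_eq_zero_of_shift {F : (Fin n → ZMod 2) → ℝ} (e : Fin n → ZMod 2)
    (h : ∀ x, F (x + e) = -F x) : ∑ x, F x = 0 := by
  have := Equiv.sum_comp (Equiv.addRight e) F
  simp only [Equiv.coe_addRight, h, Finset.sum_neg_distrib] at this
  linarith

theorem sum_chi (x : Fin n → ZMod 2) : ∑ S, chi S x = if x = 0 then 2 ^ n else 0 := by
  split_ifs with hx
  · simp [hx, chi_zero, ZMod.card]
  · obtain ⟨j, hj⟩ := exists_chi_stdBasis_eq_neg_one hx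
    exact sum_eq_zero_of_shift (stdBasis j) fun S => by rw [chi_add_left, hj]; ring

theorem fourier_inversion (f : (Fin n → ZMod 2) → ℝ) (x : Fin n → ZMod 2) :
    f x = ∑ S, fCoeff f S * chi S x := by
  simp only [fCoeff_eq, mul_assoc, ← Finset.mul_sum, Finset.sum_mul]
  rw [Finset.sum_comm]
  simp only [← Finset.mul_sum, ← chi_add, sum_chi]
  rw [Finset.sum_eq_single x]
  · rw [if_pos (add_self_zmodTwo x)]
    field_simp
  · intro y _ hy
    rw [if_neg, mul_zero]
    intro h0
    apply hy
    rw [← add_zero y, ← add_self_zmodTwo x, ← add_assoc, h0, zero_add]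
  · simp

theorem fCoeff_translate (f : (Fin n → ZMod 2) → ℝ) (a S : Fin n → ZMod 2) :
    fCoeff (fun x => f (x + a)) S = chi S a * fCoeff f S := by
  rw [fCoeff_eq, fCoeff_eq, ← Equiv.sum_comp (Equiv.addRight a) fun x => f (x + a) * chi S x,
    mul_left_comm, Finset.mul_sum _ _ (chi S a)]
  congr 1
  refine Finset.sum_congr rfl fun x _ => ?_
  simp only [Equiv.coe_addRight, add_assoc, add_self_zmodTwo, add_zero, chi_add]
  ring

theorem fCoeff_modulate (f : (Fin n → ZMod 2) → ℝ) (S T : Fin n → ZMod 2) :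
    fCoeff (fun x => f x * chi S x) T = fCoeff f (S + T) := by
  simp only [fCoeff_eq, chi_add_left, mul_assoc]

theorem fCoeff_add_translate (f : (Fin n → ZMod 2) → ℝ) (c : ℝ) (a S : Fin n → ZMod 2) :
    fCoeff (fun x => c * (f x + f (x + a))) S = c * (1 + chi S a) * fCoeff f S := by
  have h := fCoeff_translate f a S
  simp only [fCoeff_eq] at h ⊢
  simp only [mul_assoc, add_mul, Finset.sum_add_distrib, ← Finset.mul_sum] at h ⊢
  linear_combination c * h

open Finset in
theorem exists_two_mul_card_filter_le (B : Finset (Fin n → ZMod 2)) (hB : 0 ∉ B) :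
    ∃ x, 2 * #{b ∈ B | chi b x ≠ -1} ≤ #B := by
  have hsum : ∑ x, ∑ b ∈ B, chi b x = 0 := by
    rw [sum_comm]
    refine sum_eq_zero fun b hb => ?_
    simp only [chi_comm b]
    rw [sum_chi, if_neg]
    rintro rfl
    exact hB hb
  obtain ⟨x, -, hx⟩ := exists_le_of_sum_le (s := univ) (f := fun x => ∑ b ∈ B, chi b x)
    (g := fun _ => (0 : ℝ)) univ_nonempty (by simp [hsum])
  refine ⟨x, ?_⟩
  have hval : ∀ b ∈ B, chi b x = 2 * (if chi b x ≠ -1 then 1 else 0) - 1 := by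
    intro b _
    rcases chi_eq_or b x with h | h <;> norm_num [h]
  rw [sum_congr rfl hval, sum_sub_distrib, ← mul_sum, sum_boole] at hx
  simp only [sum_const, nsmul_eq_mul, mul_one, sub_nonpos] at hx
  exact_mod_cast hx

/-- Nonzero indices in the Fourier support. -/
noncomputable def offZero (f : (Fin n → ZMod 2) → ℝ) : Finset (Fin n → ZMod 2) :=
  Finset.univ.filter fun S => S ≠ 0 ∧ fCoeff f S ≠ 0

open Finset in
theorem exists_card_offZero_translate_le (f : (Fin n → ZMod 2) → ℝ) (c : ℝ) :
    ∃ a, 2 * #(offZero fun x => c * (f x + f (x + a))) ≤ #(offZero f) := by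
  obtain ⟨a, ha⟩ := exists_two_mul_card_filter_le (offZero f) (by simp [offZero])
  refine ⟨a, (Nat.mul_le_mul_left 2 (card_le_card fun S hS => ?_)).trans ha⟩
  simp only [offZero, mem_filter, mem_univ, true_and, fCoeff_add_translate] at hS ⊢
  refine ⟨⟨hS.1, right_ne_zero_of_mul hS.2⟩, fun h => hS.2 ?_⟩
  simp [h]

open Finset in
theorem exists_int_eq_two_pow_mul_fCoeff_zero (d : ℕ) (f : (Fin n → ZMod 2) → ℝ)
    (hf : ∀ x, ∃ z : ℤ, f x = z) (hcard : #(offZero f) < 2 ^ d) :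
    ∃ z : ℤ, 2 ^ d * fCoeff f 0 = z := by
  induction d generalizing f with
  | zero =>
    have hempty : offZero f = ∅ := by simpa using hcard
    obtain ⟨z, hz⟩ := hf 0
    refine ⟨z, ?_⟩
    rw [← hz, fourier_inversion f 0, sum_eq_single 0]
    · simp [chi_zero]
    · intro S _ hS
      have : S ∉ offZero f := by simp [hempty]
      have : fCoeff f S = 0 := by simpa [offZero, hS] using this
      simp [this]
    · simp
  | succ d ih =>
    obtain ⟨a, ha⟩ := exists_card_offZero_translate_le f 1
    obtain ⟨z, hz⟩ := ih (fun x => 1 * (f x + f (x + a)))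
      (fun x => by
        obtain ⟨u, hu⟩ := hf x
        obtain ⟨v, hv⟩ := hf (x + a)
        exact ⟨u + v, by simp [hu, hv]⟩) (by rw [pow_succ] at hcard; omega)
    refine ⟨z, ?_⟩
    rw [← hz, fCoeff_add_translate, chi_zero_left]
    ring

open Finset in
/-- A nonzero Fourier coefficient of a sparse Boolean function is not too small. -/
theorem one_le_two_pow_mul_abs_fCoeff (d : ℕ) (f : (Fin n → ZMod 2) → ℝ)
    (hf : ∀ x, f x = 1 ∨ f x = -1) (hcard : (fSupp f).ncard < 2 ^ (d + 1))
    (S : Fin n → ZMod 2) (hS : fCoeff f S ≠ 0) : 1 ≤ 2 ^ d * |fCoeff f S| := by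
  set g : (Fin n → ZMod 2) → ℝ := fun x => f x * chi S x with hg
  have hgS (T) : fCoeff g T = fCoeff f (S + T) := fCoeff_modulate f S T
  have hg1 (x) : g x = 1 ∨ g x = -1 := by
    rcases hf x with h | h <;> rcases chi_eq_or S x with h' | h' <;> simp [hg, h, h']
  have hgcard : #(offZero g) ≤ (fSupp f).ncard := by
    rw [← Set.ncard_coe_finset]
    refine Set.ncard_le_ncard_of_injOn (fun T => S + T) ?_ (by simp) (Set.toFinite _)
    intro T hT
    simp only [offZero, coe_filter, mem_univ, true_and, Set.mem_ofPred_eq, hgS] at hT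
    exact hT.2
  obtain ⟨a, ha⟩ := exists_card_offZero_translate_le g (1 / 2)
  obtain ⟨z, hz⟩ := exists_int_eq_two_pow_mul_fCoeff_zero d (fun x => 1 / 2 * (g x + g (x + a)))
    (fun x => by
      rcases hg1 x with h | h <;> rcases hg1 (x + a) with h' | h'
      · exact ⟨1, by rw [h, h']; norm_num⟩
      · exact ⟨0, by rw [h, h']; norm_num⟩
      · exact ⟨0, by rw [h, h']; norm_num⟩
      · exact ⟨-1, by rw [h, h']; norm_num⟩) (by rw [pow_succ] at hcard; omega)
  rw [fCoeff_add_translate, chi_zero_left, hgS, add_zero] at hz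
  have hz' : 2 ^ d * fCoeff f S = z := by rw [← hz]; ring
  have hz0 : z ≠ 0 := by
    rintro rfl
    simp [hS] at hz'
  have habs : |2 ^ d * fCoeff f S| = 2 ^ d * |fCoeff f S| := by
    rw [abs_mul, abs_of_pos (by positivity : (0 : ℝ) < 2 ^ d)]
  rw [← habs, hz']
  exact_mod_cast Int.one_le_abs hz0

open Finset in
theorem card_subcube (T : Finset (Fin n)) (b : ZMod 2) :
    #{x : Fin n → ZMod 2 | ∀ i ∈ T, x i = b} = 2 ^ (n - #T) := by
  have hset : ({x : Fin n → ZMod 2 | ∀ i ∈ T, x i = b} : Finset _)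
      = Fintype.piFinset fun i => if i ∈ T then {b} else univ := by
    ext x
    simp only [mem_filter, mem_univ, true_and, Fintype.mem_piFinset]
    refine forall_congr' fun i => ?_
    split_ifs with hi <;> simp [hi]
  have hcard : ∀ i, #(if i ∈ T then {b} else univ : Finset (ZMod 2)) = if i ∈ T then 1 else 2 := by
    intro i
    split_ifs <;> simp [ZMod.card]
  rw [hset, Fintype.card_piFinset]
  simp only [hcard, prod_ite, prod_const, one_pow, one_mul]
  rw [filter_not, filter_mem_eq_inter, univ_inter, card_sdiff_of_subset (subset_univ _),
    card_univ, Fintype.card_fin]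

open Finset in
theorem exists_sum_chi_eq_card_sub (s : Finset (Fin n → ZMod 2)) (S : Fin n → ZMod 2) :
    ∃ w : ℤ, ∑ x ∈ s, chi S x = #s - 2 * w := by
  refine ⟨#{x ∈ s | chi S x = -1}, ?_⟩
  have hval : ∀ x ∈ s, chi S x = 1 - 2 * (if chi S x = -1 then 1 else 0) := by
    intro x _
    rcases chi_eq_or S x with h | h <;> norm_num [h]
  rw [sum_congr rfl hval, sum_sub_distrib, ← mul_sum, sum_boole]
  simp

theorem sum_subcube_chi_eq_zero (T : Finset (Fin n)) (S : Fin n → ZMod 2) {i : Fin n}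
    (hi : i ∉ T) (hS : S i ≠ 0) :
    ∑ x with ∀ i ∈ T, x i = 1, chi S x = 0 := by
  rw [Finset.sum_filter]
  refine sum_eq_zero_of_shift (stdBasis i) fun x => ?_
  have hiff : (∀ j ∈ T, (x + stdBasis i) j = 1) ↔ ∀ j ∈ T, x j = 1 := by
    refine forall₂_congr fun j hj => ?_
    have : j ≠ i := fun h => hi (h ▸ hj)
    simp [stdBasis, this]
  rw [chi_add, chi_comm S (stdBasis i), chi_stdBasis, if_neg hS, if_congr hiff rfl rfl]
  split_ifs <;> simp

/-- A nonzero Fourier coefficient of the restriction to a subcube comes from one of `f`. -/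
theorem exists_fCoeff_ne_zero_of_subcube (f : (Fin n → ZMod 2) → ℝ) (T : Finset (Fin n))
    (S : Fin n → ZMod 2) (h : ∑ x with ∀ i ∈ T, x i = 1, f x * chi S x ≠ 0) :
    ∃ S', fCoeff f S' ≠ 0 ∧ ∀ i ∉ T, S' i = S i := by
  by_contra! hne
  apply h
  have hinv : ∀ x, f x * chi S x = ∑ S', fCoeff f S' * chi (S' + S) x := by
    intro x
    rw [fourier_inversion f x, Finset.sum_mul]
    simp only [chi_add_left, mul_assoc]
  simp only [hinv]
  rw [Finset.sum_comm]
  refine Finset.sum_eq_zero fun S' _ => ?_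
  rw [← Finset.mul_sum]
  by_cases h0 : fCoeff f S' = 0
  · rw [h0, zero_mul]
  · obtain ⟨i, hi, hSi⟩ := hne S' h0
    rw [sum_subcube_chi_eq_zero T _ hi, mul_zero]
    exact fun h => hSi (CharTwo.add_eq_zero.1 h)

open Finset in
/-- The set where a sparse Boolean function is `-1` meets every large subcube evenly. -/
theorem even_card_subcube (f : (Fin n → ZMod 2) → ℝ) (hf : ∀ x, f x = 1 ∨ f x = -1)
    (T : Finset (Fin n)) (hT : 2 ≤ n - #T) (hcard : (fSupp f).ncard < 2 ^ (n - #T)) :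
    Even #{x | f x = -1 ∧ ∀ i ∈ T, x i = 1} := by
  classical
  by_contra hodd
  have hclaim : ∀ S : Fin n → ZMod 2, (∀ i ∈ T, S i = 0) →
      ∃ S', fCoeff f S' ≠ 0 ∧ ∀ i ∉ T, S' i = S i := by
    intro S hS
    refine exists_fCoeff_ne_zero_of_subcube f T S fun hzero => hodd ?_
    obtain ⟨u, hu⟩ : ∃ u : ℤ, ∑ x with ∀ i ∈ T, x i = 1, chi S x = 4 * u := by
      by_cases h0 : S = 0
      · refine ⟨2 ^ (n - #T - 2), ?_⟩
        simp only [h0, chi_zero_left, sum_const, card_subcube, nsmul_eq_mul, mul_one]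
        push_cast
        rw [show (4 : ℝ) = 2 ^ 2 by norm_num, ← pow_add, Nat.add_sub_cancel' hT]
      · obtain ⟨i, hi⟩ := Function.ne_iff.1 h0
        exact ⟨0, by rw [sum_subcube_chi_eq_zero T S (fun h => hi (hS i h)) hi]; simp⟩
    obtain ⟨w, hw⟩ := exists_sum_chi_eq_card_sub ({x | f x = -1 ∧ ∀ i ∈ T, x i = 1} : Finset _) S
    have hval : ∀ x, f x * chi S x = chi S x - 2 * (if f x = -1 then chi S x else 0) := by
      intro x
      rcases hf x with h | h <;> norm_num [h]
      ring
    simp only [hval] at hzero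
    rw [sum_sub_distrib, ← mul_sum, ← sum_filter, filter_filter, hu] at hzero
    simp only [and_comm] at hzero hw ⊢
    rw [hw] at hzero
    have hint : (#{x | f x = -1 ∧ ∀ i ∈ T, x i = 1} : ℤ) = 2 * (u + w) := by
      have : (#{x | f x = -1 ∧ ∀ i ∈ T, x i = 1} : ℝ) = 2 * (u + w) := by linarith
      exact_mod_cast this
    rw [← Int.even_coe_nat, hint]
    exact even_two_mul _
  refine hcard.not_ge ?_
  rw [← card_subcube T 0, ← Set.ncard_coe_finset]
  refine (Set.ncard_le_ncard ?_ (Set.toFinite _)).trans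
    (Set.ncard_image_le (f := fun S' i => if i ∈ T then 0 else S' i) (Set.toFinite (fSupp f)))
  intro S hS
  have hS0 : ∀ i ∈ T, S i = 0 := by simpa using hS
  obtain ⟨S', hS', hagree⟩ := hclaim S hS0
  refine ⟨S', hS', funext fun i => ?_⟩
  by_cases hi : i ∈ T
  · simp [hi, hS0 i hi]
  · simp [hi, hagree i hi]

open Finset in
theorem neg_sum_fCoeff_stdBasis_le (f : (Fin n → ZMod 2) → ℝ) (hf : ∀ x, f x = 1 ∨ f x = -1)
    (N : ℕ) (h : ∀ T : Finset (Fin n), #T < N → Even #{x | f x = -1 ∧ ∀ i ∈ T, x i = 1}) :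
    -∑ j, fCoeff f (stdBasis j) ≤ (n - N) * (1 - fCoeff f 0) := by
  classical
  let A : Finset (Fin n → ZMod 2) := {x | f x = -1}
  let supp : (Fin n → ZMod 2) → Finset (Fin n) := fun x => {i | x i = 1}
  have hsupp : Function.Injective supp := by
    intro x y hxy
    funext i
    have hi : x i = 1 ↔ y i = 1 := by simpa [supp] using congrArg (i ∈ ·) hxy
    revert hi
    generalize x i = a
    generalize y i = b
    revert a b
    decide
  have hweight : N * #A ≤ 2 * ∑ x ∈ A, #(supp x) := by
    have := card_mul_le_two_mul_sum_card (A.image supp) N fun T hT => by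
      rw [filter_image, card_image_of_injective _ hsupp, filter_filter]
      simpa [supp, subset_iff] using h T hT
    rwa [card_image_of_injective _ hsupp, sum_image hsupp.injOn] at this
  have hcoeff : ∀ S, fCoeff f S = 1 / 2 ^ n * (∑ x, chi S x - 2 * ∑ x ∈ A, chi S x) := by
    intro S
    rw [fCoeff_eq, sum_filter, mul_sum univ _ (2 : ℝ), ← sum_sub_distrib]
    congr 1
    refine sum_congr rfl fun x _ => ?_
    rcases hf x with h | h <;> norm_num [h]
    ring
  have hzero : 1 - fCoeff f 0 = 1 / 2 ^ n * (2 * #A) := by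
    rw [hcoeff]
    simp only [chi_zero_left, sum_const, card_univ, Fintype.card_fun, ZMod.card, Fintype.card_fin,
      nsmul_eq_mul, mul_one]
    push_cast
    field_simp
    ring
  have hbasis : ∀ j, fCoeff f (stdBasis j) = 1 / 2 ^ n * (-2 * ∑ x ∈ A, chi (stdBasis j) x) := by
    intro j
    have hj : (stdBasis j : Fin n → ZMod 2) ≠ 0 := fun h => by
      simpa [stdBasis] using congrFun h j
    rw [hcoeff]
    simp only [chi_comm (stdBasis j)]
    rw [sum_chi, if_neg hj]
    ring
  have hsum : ∀ x, ∑ j, chi (stdBasis j) x = n - 2 * #(supp x) := by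
    intro x
    have hval : ∀ j, chi (stdBasis j) x = 1 - 2 * (if x j = 1 then 1 else 0) := by
      intro j
      have hcases : ∀ a : ZMod 2, a = 0 ∨ a = 1 := by decide
      rw [chi_stdBasis]
      rcases hcases (x j) with h | h <;> norm_num [h]
    simp only [hval, sum_sub_distrib, ← mul_sum, sum_boole]
    simp [supp]
  have htotal : -∑ j, fCoeff f (stdBasis j)
      = 1 / 2 ^ n * (2 * (n * #A - 2 * ∑ x ∈ A, (#(supp x) : ℝ))) := by
    simp only [hbasis, ← mul_sum]
    rw [sum_comm]
    simp only [hsum, sum_sub_distrib, ← mul_sum, sum_const, nsmul_eq_mul]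
    ring
  have hweight' : (N : ℝ) * #A ≤ 2 * ∑ x ∈ A, (#(supp x) : ℝ) := by exact_mod_cast hweight
  rw [htotal, hzero, mul_left_comm ((n : ℝ) - N)]
  refine mul_le_mul_of_nonneg_left ?_ (by positivity)
  linarith

theorem fCoeff_zero_le_one (f : (Fin n → ZMod 2) → ℝ) (hf : ∀ x, f x = 1 ∨ f x = -1) :
    fCoeff f 0 ≤ 1 := by
  have hle : ∑ x, f x ≤ ∑ _x : Fin n → ZMod 2, (1 : ℝ) :=
    Finset.sum_le_sum fun x _ => by rcases hf x with h | h <;> norm_num [h]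
  simp only [Finset.sum_const, Finset.card_univ, Fintype.card_fun, ZMod.card, Fintype.card_fin,
    nsmul_eq_mul, mul_one] at hle
  simp only [fCoeff_eq, chi_zero_left, mul_one]
  rw [one_div, inv_mul_le_iff₀ (by positivity), mul_one]
  push_cast at hle
  exact hle

theorem fSupp_translate (f : (Fin n → ZMod 2) → ℝ) (a : Fin n → ZMod 2) :
    fSupp (fun x => f (x + a)) = fSupp f := by
  ext S
  have : chi S a ≠ 0 := by rcases chi_eq_or S a with h | h <;> norm_num [h]
  simp [fSupp, fCoeff_translate, this]

/-- Bound on the sum of the level-one Fourier coefficients of a sparse Boolean function. -/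
theorem sum_abs_fCoeff_stdBasis_le (d : ℕ) (hd : 1 ≤ d) (f : (Fin n → ZMod 2) → ℝ)
    (hf : ∀ x, f x = 1 ∨ f x = -1) (hcard : (fSupp f).ncard < 2 ^ (d + 1)) :
    ∑ j, |fCoeff f (stdBasis j)| ≤ d * (1 - fCoeff f 0) := by
  let a : Fin n → ZMod 2 := fun j => if 0 ≤ fCoeff f (stdBasis j) then 1 else 0
  have hlevel := neg_sum_fCoeff_stdBasis_le (fun x => f (x + a)) (fun x => hf _) (n - d)
    fun T hT => even_card_subcube _ (fun x => hf _) T (by omega) (by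
      rw [fSupp_translate]
      exact hcard.trans_le (Nat.pow_le_pow_right two_pos (by omega)))
  have hsign : ∀ j, chi (stdBasis j) a * fCoeff f (stdBasis j) = -|fCoeff f (stdBasis j)| := by
    intro j
    rw [chi_stdBasis]
    by_cases h : 0 ≤ fCoeff f (stdBasis j)
    · simp [a, h, abs_of_nonneg h]
    · simp [a, h, abs_of_neg (not_le.1 h)]
  simp only [fCoeff_translate, hsign, Finset.sum_neg_distrib, neg_neg, chi_zero_left,
    one_mul] at hlevel
  refine hlevel.trans (mul_le_mul_of_nonneg_right ?_ (sub_nonneg.2 (fCoeff_zero_le_one f hf)))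
  have : (n : ℝ) ≤ (n - d : ℕ) + d := by exact_mod_cast le_tsub_add
  linarith

end Characters

/-- If `f : 𝔽₂^r → {−1,1}` is `k`-Fourier-sparse with `f̂(e_j) ≠ 0` for every `j ∈ [r]`,
then `1 − f̂(0^r) ≥ r/(k·log₂ k)`. -/
theorem sparse_zero_coeff_bound {k r : ℕ} (hk : 2 ≤ k) (hr : 1 ≤ r)
    (f : (Fin r → ZMod 2) → ℝ) (hf : ∀ x, f x = 1 ∨ f x = -1)
    (hsparse : (fSupp f).ncard ≤ k)
    (hcoeff : ∀ j : Fin r, fCoeff f (stdBasis j) ≠ 0) :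
    (r : ℝ) / (k * Real.logb 2 k) ≤ 1 - fCoeff f 0 := by
  set d := Nat.log 2 k with hd
  have hd1 : 1 ≤ d := Nat.log_pos one_lt_two hk
  have hcard : (fSupp f).ncard < 2 ^ (d + 1) :=
    hsparse.trans_lt (Nat.lt_pow_succ_log_self one_lt_two k)
  have hlevel := sum_abs_fCoeff_stdBasis_le d hd1 f hf hcard
  have hr_le : (r : ℝ) ≤ 2 ^ d * ∑ j, |fCoeff f (stdBasis j)| := by
    rw [Finset.mul_sum]
    simpa using Finset.sum_le_sum fun j (_ : j ∈ Finset.univ) =>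
      one_le_two_pow_mul_abs_fCoeff d f hf hcard (stdBasis j) (hcoeff j)
  have hpow : (2 : ℝ) ^ d ≤ k := by exact_mod_cast Nat.pow_log_le_self 2 (by omega)
  have hlog : (d : ℝ) ≤ Real.logb 2 k := by
    rw [Real.le_logb_iff_rpow_le one_lt_two (by positivity), Real.rpow_natCast]
    exact hpow
  have hdpos : (0 : ℝ) < d := by exact_mod_cast hd1
  have hkpos : (0 : ℝ) < k := by positivity
  rw [div_le_iff₀ (mul_pos hkpos (hdpos.trans_le hlog)), mul_comm]
  calc (r : ℝ) ≤ 2 ^ d * (d * (1 - fCoeff f 0)) :=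
        hr_le.trans (mul_le_mul_of_nonneg_left hlevel (by positivity))
    _ = 2 ^ d * d * (1 - fCoeff f 0) := by ring
    _ ≤ k * Real.logb 2 k * (1 - fCoeff f 0) :=
        mul_le_mul_of_nonneg_right (mul_le_mul hpow hlog hdpos.le hkpos.le)
          (sub_nonneg.2 (fCoeff_zero_le_one f hf))
end

section
/- Let n ≥ 1, k ≥ 2, and let f : 𝔽₂ⁿ → {−1,1} be a k-Fourier-sparse Boolean function with Fourier span 𝒱 and Fourier dimension r. Then for every r' ≥ 0 and every subset 𝒮 ⊆ 𝒱 with dim(span(𝒮)) = r', the Fourier weight of f on span(𝒮) satisfies Σ_{S ∈ span(𝒮)} f̂(S)² ≤ 1 − (r − r')/(k·log₂ k). -/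
attribute [local instance] Classical.propDecidable

open Finset

/-- The Walsh character of `𝔽₂ⁿ` indexed by `S`. -/
noncomputable def walsh {n : ℕ} (S x : Fin n → ZMod 2) : ℝ :=
  (-1) ^ (∑ i, (S i).val * (x i).val)

section walsh

variable {n : ℕ} (S T x y : Fin n → ZMod 2)

lemma walsh_eq_ite : walsh S x = if S ⬝ᵥ x = 0 then 1 else -1 := by
  have h : ((∑ i, (S i).val * (x i).val : ℕ) : ZMod 2) = S ⬝ᵥ x := by
    simp [dotProduct]
  rw [← h, walsh]
  split_ifs with he
  · exact (ZMod.natCast_eq_zero_iff_even.1 he).neg_one_pow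
  · exact (Nat.not_even_iff_odd.1 (mt ZMod.natCast_eq_zero_iff_even.2 he)).neg_one_pow

lemma walsh_comm : walsh S x = walsh x S := by
  simp only [walsh, mul_comm]

lemma walsh_add_right : walsh S (x + y) = walsh S x * walsh S y := by
  simp only [walsh, ← pow_add, neg_one_pow_eq_pow_mod_two (n := ∑ i, (S i).val * ((x + y) i).val),
    neg_one_pow_eq_pow_mod_two (n := ∑ i, (S i).val * (x i).val + ∑ i, (S i).val * (y i).val)]
  congr 1
  rw [← Nat.ModEq, ← ZMod.natCast_eq_natCast_iff]
  simp [mul_add, sum_add_distrib]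

lemma walsh_add_left : walsh (S + T) x = walsh S x * walsh T x := by
  simp only [walsh_comm _ x, walsh_add_right]

lemma walsh_eq_one_iff : walsh S x = 1 ↔ S ⬝ᵥ x = 0 := by
  rw [walsh_eq_ite]; split_ifs with h <;> simp [h]; norm_num

end walsh

/-- The subspace of vectors orthogonal to `W` for the dot product on `𝔽₂ⁿ`. -/
noncomputable def dotPerp {n : ℕ} (W : Submodule (ZMod 2) (Fin n → ZMod 2)) :
    Submodule (ZMod 2) (Fin n → ZMod 2) :=
  LinearMap.BilinForm.orthogonal (dotProductBilin (ZMod 2) (ZMod 2)) W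

section dotPerp

variable {n : ℕ}

lemma dotProductBilin_isRefl :
    LinearMap.BilinForm.IsRefl
      (dotProductBilin (ZMod 2) (ZMod 2) : LinearMap.BilinForm (ZMod 2) (Fin n → ZMod 2)) := by
  intro x y h
  simpa [dotProduct_comm] using h

lemma dotProductBilin_nondegenerate :
    LinearMap.BilinForm.Nondegenerate
      (dotProductBilin (ZMod 2) (ZMod 2) : LinearMap.BilinForm (ZMod 2) (Fin n → ZMod 2)) := by
  refine ⟨fun x h => dotProduct_eq_zero x h, fun x h => dotProduct_eq_zero x fun w => ?_⟩
  rw [dotProduct_comm]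
  exact h w

variable (W : Submodule (ZMod 2) (Fin n → ZMod 2))

lemma mem_dotPerp {x : Fin n → ZMod 2} : x ∈ dotPerp W ↔ ∀ S ∈ W, S ⬝ᵥ x = 0 :=
  LinearMap.BilinForm.mem_orthogonal_iff

lemma dotPerp_dotPerp : dotPerp (dotPerp W) = W :=
  LinearMap.BilinForm.orthogonal_orthogonal dotProductBilin_nondegenerate
    dotProductBilin_isRefl W

lemma card_dotPerp :
    (Fintype.card (dotPerp W) : ℝ) * 2 ^ Module.finrank (ZMod 2) W = 2 ^ n := by
  have h : Module.finrank (ZMod 2) (dotPerp W) = n - Module.finrank (ZMod 2) W := by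
    have := LinearMap.BilinForm.finrank_orthogonal
      (dotProductBilin_nondegenerate (n := n)) W
    rwa [Module.finrank_fin_fun] at this
  have hle : Module.finrank (ZMod 2) W ≤ n := by
    simpa using Submodule.finrank_le W
  rw [Module.card_eq_pow_finrank (K := ZMod 2), h, ZMod.card]
  push_cast
  rw [← pow_add, Nat.sub_add_cancel hle]

lemma sum_walsh_dotPerp (S : Fin n → ZMod 2) :
    ∑ h : dotPerp W, walsh S h = if S ∈ W then (Fintype.card (dotPerp W) : ℝ) else 0 := by
  split_ifs with hS
  · rw [sum_congr rfl fun (h : dotPerp W) _ => (walsh_eq_one_iff S h).2 ((mem_dotPerp W).1 h.2 S hS)]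
    simp
  · obtain ⟨h₀, hh₀⟩ : ∃ h₀ : dotPerp W, walsh S h₀ ≠ 1 := by
      by_contra! hcon
      apply hS
      rw [← dotPerp_dotPerp W, mem_dotPerp]
      intro h hh
      rw [dotProduct_comm]
      exact (walsh_eq_one_iff S h).1 (hcon ⟨h, hh⟩)
    have h₁ : ∑ h : dotPerp W, walsh S h = walsh S h₀ * ∑ h : dotPerp W, walsh S h := by
      rw [mul_sum, ← Equiv.sum_comp (Equiv.addLeft h₀)]
      exact sum_congr rfl fun h _ => by simp [walsh_add_right]
    have h₂ : (walsh S h₀ - 1) * ∑ h : dotPerp W, walsh S h = 0 := by linarith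
    exact (mul_eq_zero.1 h₂).resolve_left (sub_ne_zero.2 hh₀)

lemma sum_walsh (S : Fin n → ZMod 2) :
    ∑ x, walsh S x = if S = 0 then (2 : ℝ) ^ n else 0 := by
  have h := sum_walsh_dotPerp (⊥ : Submodule (ZMod 2) (Fin n → ZMod 2)) S
  have htop : dotPerp (⊥ : Submodule (ZMod 2) (Fin n → ZMod 2)) = ⊤ := by
    ext x; simp [mem_dotPerp]
  have hc := card_dotPerp (⊥ : Submodule (ZMod 2) (Fin n → ZMod 2))
  rw [finrank_bot, pow_zero, mul_one] at hc
  rw [hc, Submodule.mem_bot] at h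
  let e : dotPerp (⊥ : Submodule (ZMod 2) (Fin n → ZMod 2)) ≃ (Fin n → ZMod 2) :=
    Equiv.subtypeUnivEquiv fun x => by simp [htop]
  refine (Equiv.sum_comp e fun x => walsh S x).symm.trans (h.trans ?_)
  split_ifs <;> rfl

lemma sum_walsh_mul (S T : Fin n → ZMod 2) :
    ∑ x, walsh S x * walsh T x = if S = T then (2 : ℝ) ^ n else 0 := by
  have h : S + T = 0 ↔ S = T := by
    rw [← sub_eq_zero (a := S) (b := T), sub_eq_add_neg, ZModModule.neg_eq_self]
  simp only [← walsh_add_left, sum_walsh, h]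

end dotPerp

section fourier

variable {n : ℕ} (f : (Fin n → ZMod 2) → ℝ)

lemma fCoeff_eq_sum_walsh (S : Fin n → ZMod 2) :
    fCoeff f S = (1 / 2 ^ n) * ∑ x, f x * walsh S x := rfl

lemma sum_fCoeff_mul_walsh (x : Fin n → ZMod 2) : ∑ S, fCoeff f S * walsh S x = f x := by
  have h : ∀ S, fCoeff f S * walsh S x =
      ∑ y, (1 / 2 ^ n) * f y * (walsh y S * walsh x S) := fun S => by
    rw [fCoeff_eq_sum_walsh, mul_sum, sum_mul]
    exact sum_congr rfl fun y _ => by rw [walsh_comm S y, walsh_comm S x]; ring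
  rw [sum_congr rfl fun S _ => h S, sum_comm]
  simp only [← mul_sum, sum_walsh_mul]
  simp
  field_simp

lemma sum_fSupp_mul_walsh (x : Fin n → ZMod 2) :
    ∑ S : fSupp f, fCoeff f S * walsh (S : Fin n → ZMod 2) x = f x := by
  rw [← sum_fCoeff_mul_walsh f x,
    ← sum_filter_of_ne (p := (· ∈ fSupp f)) fun S _ h => left_ne_zero_of_mul h]
  exact (sum_subtype _ (by simp) fun S => fCoeff f S * walsh S x).symm

lemma sum_sq_sum_walsh (a : (Fin n → ZMod 2) → ℝ) :
    ∑ x, (∑ S, a S * walsh S x) ^ 2 = 2 ^ n * ∑ S, a S ^ 2 := by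
  have h : ∀ x, (∑ S, a S * walsh S x) ^ 2 =
      ∑ S, ∑ T, a S * a T * (walsh S x * walsh T x) := fun x => by
    rw [sq, sum_mul_sum]
    exact sum_congr rfl fun S _ => sum_congr rfl fun T _ => by ring
  rw [sum_congr rfl fun x _ => h x, sum_comm, mul_sum]
  refine sum_congr rfl fun S _ => ?_
  rw [sum_comm]
  simp only [← mul_sum, sum_walsh_mul]
  simp
  ring

end fourier

lemma exists_interpolation {X ι : Type*} [Fintype ι] (v : X → ι → ℝ) :
    ∃ (m : ℕ) (t : Fin m → X), m ≤ Fintype.card ι ∧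
      ∀ c : ι → ℝ, (∀ i, v (t i) ⬝ᵥ c = 0) → ∀ x, v x ⬝ᵥ c = 0 := by
  obtain ⟨g, hg, hspan, -⟩ := Submodule.exists_fun_fin_finrank_span_eq ℝ (Set.range v)
  choose t ht using hg
  refine ⟨_, t, ?_, fun c hc x => ?_⟩
  · simpa using Submodule.finrank_le (Submodule.span ℝ (Set.range v))
  · have hx : v x ∈ Submodule.span ℝ (Set.range g) :=
      hspan.symm ▸ Submodule.subset_span (Set.mem_range_self x)
    generalize v x = w at hx
    clear hspan
    induction hx using Submodule.span_induction with
    | mem u hu => obtain ⟨i, rfl⟩ := hu; rw [← ht]; exact hc i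
    | zero => simp
    | add u w _ _ hu hw => simp [add_dotProduct, hu, hw]
    | smul a u _ hu => simp [smul_dotProduct, hu]

lemma neg_log_one_sub_le {p : ℝ} (h₀ : 0 ≤ p) (h₁ : p ≤ 1 / 2) :
    -Real.log (1 - p) ≤ 2 * p * Real.log 2 := by
  have h := strictConcaveOn_log_Ioi.concaveOn.2 (show (1 : ℝ) ∈ Set.Ioi 0 by simp)
    (show (1 / 2 : ℝ) ∈ Set.Ioi 0 by simp) (show 0 ≤ 1 - 2 * p by linarith)
    (show 0 ≤ 2 * p by linarith) (by ring)
  simp only [smul_eq_mul, one_div, Real.log_one, Real.log_inv] at h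
  rw [show (1 - 2 * p) * 1 + 2 * p * 2⁻¹ = 1 - p by ring] at h
  linarith

lemma binEntropy_le_of_le_half {p k : ℝ} (hk : 2 ≤ k) (h₀ : 1 ≤ k * p) (h₁ : p ≤ 1 / 2) :
    Real.binEntropy p ≤ 4 * p * (1 - p) * Real.log k := by
  have hp : 0 < p := by nlinarith
  have hlog2 : 0 < Real.log 2 := Real.log_pos (by norm_num)
  have hlogk : Real.log 2 ≤ Real.log k := Real.log_le_log (by norm_num) hk
  have h₂ : Real.log p⁻¹ ≤ Real.log k :=
    Real.log_le_log (by positivity) ((inv_le_iff_one_le_mul₀ hp).2 h₀)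
  have h₃ := neg_log_one_sub_le hp.le h₁
  rw [Real.binEntropy, Real.log_inv (1 - p)]
  calc p * Real.log p⁻¹ + (1 - p) * -Real.log (1 - p)
      ≤ p * Real.log k + (1 - p) * (2 * p * Real.log k) := by
        gcongr
        · linarith
        · exact h₃.trans (by gcongr)
    _ ≤ 4 * p * (1 - p) * Real.log k := by
        nlinarith [mul_nonneg (mul_nonneg hp.le (hlog2.le.trans hlogk))
          (sub_nonneg.2 (show 2 * p ≤ 1 by linarith))]

lemma binEntropy_le {p k : ℝ} (hk : 2 ≤ k) (h₀ : p = 0 ∨ 1 ≤ k * p)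
    (h₁ : 1 - p = 0 ∨ 1 ≤ k * (1 - p)) :
    Real.binEntropy p ≤ 4 * p * (1 - p) * Real.log k := by
  rcases h₀ with rfl | h₀
  · simp
  rcases h₁ with h₁ | h₁
  · obtain rfl : p = 1 := by linarith
    simp
  rcases le_total p (1 / 2) with h | h
  · exact binEntropy_le_of_le_half hk h₀ h
  · rw [← Real.binEntropy_one_sub]
    refine (binEntropy_le_of_le_half hk h₁ (by linarith)).trans_eq (by ring)

/-- Subadditivity of entropy for a uniformly random element of `H` observed through sign
functions `b · i`, whose joint fibres have at most `M` elements. -/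
lemma log_card_div_le_sum_binEntropy {H : Type*} [Fintype H] [Nonempty H] {m : ℕ}
    (b : H → Fin m → ℝ) (hb : ∀ h i, b h i = 1 ∨ b h i = -1) (g : Fin m → ℝ)
    (hg : ∀ i, Fintype.card H * g i = ∑ h, b h i) {M : ℝ} (hM : 0 < M)
    (hfib : ∀ h, (#{h' | b h' = b h} : ℝ) ≤ M) :
    Real.log (Fintype.card H / M) ≤ ∑ i, Real.binEntropy ((1 + g i) / 2) := by
  set N : ℝ := (Fintype.card H : ℝ) with hN
  have hNpos : 0 < N := by simpa [hN] using Fintype.card_pos (α := H)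
  have habs : ∀ i, -1 ≤ g i ∧ g i ≤ 1 := fun i => by
    have h₁ : ∑ h, b h i ≤ ∑ _h : H, (1 : ℝ) :=
      sum_le_sum fun h _ => by rcases hb h i with h | h <;> simp [h]
    have h₂ : ∑ _h : H, (-1 : ℝ) ≤ ∑ h, b h i :=
      sum_le_sum fun h _ => by rcases hb h i with h | h <;> simp [h]
    rw [← hg] at h₁ h₂
    simp only [sum_const, card_univ, nsmul_eq_mul, ← hN] at h₁ h₂
    constructor <;> nlinarith
  have hpos : ∀ h i, 0 < (1 + b h i * g i) / 2 := fun h i => by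
    have h₁ : N * (1 + b h i * g i) = ∑ h', (1 + b h i * b h' i) := by
      rw [sum_add_distrib, ← mul_sum, ← hg]
      simp [← hN]
      ring
    have h₂ : 0 < ∑ h', (1 + b h i * b h' i) := by
      refine sum_pos' (fun h' _ => ?_) ⟨h, mem_univ _, ?_⟩
      · rcases hb h i with h₀ | h₀ <;> rcases hb h' i with h₀' | h₀' <;> rw [h₀, h₀'] <;> norm_num
      · rcases hb h i with h₀ | h₀ <;> rw [h₀] <;> norm_num
    rw [← h₁] at h₂
    have := pos_of_mul_pos_right h₂ hNpos.le
    positivity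
  let q : (Fin m → ℝ) → ℝ := fun s => ∏ i, (1 + s i * g i) / 2
  let P : Finset (Fin m → ℝ) := Fintype.piFinset fun _ => {1, -1}
  have hqsum : ∑ s ∈ P, q s = 1 := by
    simp only [P, q]
    rw [← prod_univ_sum (fun _ => {1, -1}) fun i j => (1 + j * g i) / 2]
    refine prod_eq_one fun i _ => ?_
    rw [sum_pair (by norm_num)]
    ring
  have hqnonneg : ∀ s ∈ P, 0 ≤ q s := fun s hs => by
    refine prod_nonneg fun i _ => ?_
    have := Fintype.mem_piFinset.1 hs i
    simp only [mem_insert, mem_singleton] at this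
    have := habs i
    rcases ‹s i = 1 ∨ s i = -1› with h | h <;> rw [h] <;> linarith
  have hqM : ∑ h, q (b h) ≤ M := by
    rw [← sum_fiberwise_of_maps_to (t := P) (g := b) fun h _ =>
      Fintype.mem_piFinset.2 fun i => by simpa using hb h i]
    calc ∑ s ∈ P, ∑ h with b h = s, q (b h) ≤ ∑ s ∈ P, M * q s := by
          refine sum_le_sum fun s hs => ?_
          rw [sum_congr rfl fun h hh => congrArg q (mem_filter.1 hh).2, sum_const, nsmul_eq_mul]
          refine mul_le_mul_of_nonneg_right ?_ (hqnonneg s hs)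
          by_cases hex : ∃ h, b h = s
          · obtain ⟨h, rfl⟩ := hex
            exact hfib h
          · rw [filter_false_of_mem fun h _ hh => hex ⟨h, hh⟩]
            simpa using hM.le
      _ = M := by rw [← mul_sum, hqsum, mul_one]
  have hlogq : ∑ h, Real.log (q (b h)) = -(N * ∑ i, Real.binEntropy ((1 + g i) / 2)) := by
    simp only [q]
    rw [sum_congr rfl fun h _ => Real.log_prod fun i _ => (hpos h i).ne', sum_comm, mul_sum,
      ← sum_neg_distrib]
    refine sum_congr rfl fun i _ => ?_
    have h₁ : ∀ h, Real.log ((1 + b h i * g i) / 2) =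
        (Real.log ((1 + g i) / 2) + Real.log ((1 - g i) / 2)) / 2 +
        b h i * ((Real.log ((1 + g i) / 2) - Real.log ((1 - g i) / 2)) / 2) := fun h => by
      rcases hb h i with h | h <;> rw [h]
      · rw [one_mul]; ring
      · rw [show 1 + -1 * g i = 1 - g i by ring]; ring
    rw [sum_congr rfl fun h _ => h₁ h, sum_add_distrib, ← sum_mul, ← hg, Real.binEntropy,
      Real.log_inv, Real.log_inv, show 1 - (1 + g i) / 2 = (1 - g i) / 2 by ring]
    simp only [sum_const, card_univ, nsmul_eq_mul, ← hN]
    ring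
  have hgibbs : ∑ h, (Real.log (q (b h)) + Real.log (N / M)) ≤ ∑ h, (q (b h) * (N / M) - 1) := by
    refine sum_le_sum fun h _ => ?_
    have hq : 0 < q (b h) := prod_pos fun i _ => hpos h i
    rw [← Real.log_mul hq.ne' (by positivity)]
    exact Real.log_le_sub_one_of_pos (by positivity)
  rw [sum_add_distrib, sum_sub_distrib, ← sum_mul, hlogq] at hgibbs
  simp only [sum_const, card_univ, nsmul_eq_mul, ← hN, mul_one] at hgibbs
  have h₁ : (∑ h, q (b h)) * (N / M) ≤ N := by
    calc (∑ h, q (b h)) * (N / M) ≤ M * (N / M) := by gcongr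
      _ = N := by field_simp
  have h₂ : N * Real.log (N / M) ≤ N * ∑ i, Real.binEntropy ((1 + g i) / 2) := by linarith
  exact le_of_mul_le_mul_left h₂ hNpos

/-- The average of `f` over the coset `y + W^⊥`. -/
noncomputable def perpMean {n : ℕ} (f : (Fin n → ZMod 2) → ℝ)
    (W : Submodule (ZMod 2) (Fin n → ZMod 2)) (y : Fin n → ZMod 2) : ℝ :=
  (∑ h : dotPerp W, f (y + h)) / Fintype.card (dotPerp W)

section perpMean

variable {n : ℕ} (f : (Fin n → ZMod 2) → ℝ) (W : Submodule (ZMod 2) (Fin n → ZMod 2))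

lemma card_mul_perpMean (y : Fin n → ZMod 2) :
    Fintype.card (dotPerp W) * perpMean f W y = ∑ h : dotPerp W, f (y + h) :=
  mul_div_cancel₀ _ (by simp)

lemma perpMean_eq_sum (y : Fin n → ZMod 2) :
    perpMean f W y = ∑ S, (if S ∈ W then fCoeff f S else 0) * walsh S y := by
  have hN : (Fintype.card (dotPerp W) : ℝ) ≠ 0 := by simp
  refine mul_left_cancel₀ hN ?_
  rw [card_mul_perpMean, sum_congr rfl fun (h : dotPerp W) _ =>
    (sum_fCoeff_mul_walsh f (y + h)).symm, sum_comm, mul_sum]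
  refine sum_congr rfl fun S _ => ?_
  simp only [walsh_add_right, ← mul_assoc]
  rw [← mul_sum, sum_walsh_dotPerp]
  split_ifs <;> ring

lemma sum_perpMean_sq :
    ∑ y, perpMean f W y ^ 2 = 2 ^ n * ∑ S, (if S ∈ W then fCoeff f S ^ 2 else 0) := by
  simp only [perpMean_eq_sum, sum_sq_sum_walsh]
  congr 1
  exact sum_congr rfl fun S _ => by split_ifs <;> simp

variable {f} {k : ℕ}

/-- Granularity: the averages of a sparse sign function over cosets of `W^⊥` stay away from `ε`,
unless the function is constant on the coset. -/
lemma perpMean_granular (hf : ∀ x, f x = 1 ∨ f x = -1) (hk : 2 ≤ k)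
    (hsparse : (fSupp f).ncard ≤ k) (y : Fin n → ZMod 2) {ε : ℝ} (hε : ε = 1 ∨ ε = -1) :
    (1 - ε * perpMean f W y) / 2 = 0 ∨ 1 ≤ k * ((1 - ε * perpMean f W y) / 2) := by
  have hk' : (2 : ℝ) ≤ k := by exact_mod_cast hk
  have hN : (0 : ℝ) < Fintype.card (dotPerp W) := by simp [Fintype.card_pos]
  by_cases hS : ∃ S₀ ∈ fSupp f, S₀ ∈ W
  swap
  · have h₀ : perpMean f W y = 0 := by
      rw [perpMean_eq_sum]
      refine sum_eq_zero fun S _ => ?_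
      split_ifs with h
      · rw [not_not.1 fun h' => hS ⟨S, h', h⟩, zero_mul]
      · rw [zero_mul]
    right
    rw [h₀]
    linarith
  obtain ⟨S₀, hS₀, hS₀W⟩ := hS
  let u : (Fin n → ZMod 2) → ℝ := fun x => (1 - ε * f x) / 2
  have hu : ∀ x, u x = 0 ∨ u x = 1 := fun x => by
    simp only [u]
    rcases hε with h | h <;> rcases hf x with h' | h' <;> rw [h, h'] <;> norm_num
  have hmean : Fintype.card (dotPerp W) * ((1 - ε * perpMean f W y) / 2) =
      ∑ h : dotPerp W, u (y + h) := by
    simp only [u, ← sum_div, sum_sub_distrib, ← mul_sum, ← card_mul_perpMean]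
    simp
    ring
  by_cases hconst : ∀ h : dotPerp W, u (y + h) = 0
  · left
    rw [sum_congr rfl fun h _ => hconst h, sum_const_zero] at hmean
    exact (mul_eq_zero.1 hmean).resolve_left hN.ne'
  right
  obtain ⟨m, t, hm, ht⟩ := exists_interpolation
    fun (h : dotPerp W) (S : fSupp f) => walsh (S : Fin n → ZMod 2) h
  have hm' : (m : ℝ) ≤ k := by
    rw [← Nat.card_eq_fintype_card, Nat.card_coe_set_eq] at hm
    exact_mod_cast hm.trans hsparse
  have hrep : ∀ z, ∃ c : fSupp f → ℝ, ∀ h : dotPerp W,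
      (fun S : fSupp f => walsh (S : Fin n → ZMod 2) h) ⬝ᵥ c = u (z + h) := fun z => by
    refine ⟨fun S => ((if S = ⟨S₀, hS₀⟩ then 1 else 0) -
      ε * (fCoeff f S * walsh (S : Fin n → ZMod 2) z)) / 2, fun h => ?_⟩
    have h₁ : walsh S₀ h = 1 := (walsh_eq_one_iff _ _).2 ((mem_dotPerp W).1 h.2 _ hS₀W)
    have h₂ : ∀ S : fSupp f, walsh (S : Fin n → ZMod 2) h *
        (((if S = ⟨S₀, hS₀⟩ then 1 else 0) -
          ε * (fCoeff f S * walsh (S : Fin n → ZMod 2) z)) / 2) =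
        ((if S = ⟨S₀, hS₀⟩ then walsh (S : Fin n → ZMod 2) h else 0) -
          ε * (fCoeff f S * walsh (S : Fin n → ZMod 2) (z + h))) / 2 := fun S => by
      rw [walsh_add_right]
      split_ifs <;> ring
    simp only [dotProduct, h₂, u]
    rw [← sum_div, sum_sub_distrib, ← mul_sum, sum_fSupp_mul_walsh, Fintype.sum_ite_eq', h₁]
  have hhit : ∀ h : dotPerp W, 1 ≤ ∑ i, u (y + h + t i) := fun h => by
    by_contra! hlt
    have hzero : ∀ i, u (y + h + t i) = 0 := fun i => by
      refine (hu _).resolve_right fun h₁ => hlt.not_ge ?_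
      rw [← h₁]
      exact single_le_sum (f := fun i => u (y + h + t i))
        (fun j _ => by rcases hu (y + h + t j) with h | h <;> simp [h]) (mem_univ i)
    obtain ⟨c, hc⟩ := hrep (y + h)
    refine hconst fun h' => ?_
    have := hc (h' - h) ▸ ht c (fun i => by rw [hc, hzero]) (h' - h)
    simpa [add_assoc] using this
  have hsum : (Fintype.card (dotPerp W) : ℝ) ≤
      m * (Fintype.card (dotPerp W) * ((1 - ε * perpMean f W y) / 2)) := by
    calc (Fintype.card (dotPerp W) : ℝ) = ∑ _h : dotPerp W, (1 : ℝ) := by simp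
      _ ≤ ∑ h : dotPerp W, ∑ i, u (y + h + t i) := sum_le_sum fun h _ => hhit h
      _ = ∑ _i : Fin m, ∑ h : dotPerp W, u (y + h) := by
        rw [sum_comm]
        refine sum_congr rfl fun i _ => ?_
        refine Eq.trans ?_
          (Equiv.sum_comp (Equiv.addRight (t i)) fun h : dotPerp W => u (y + h))
        exact sum_congr rfl fun h _ => by simp [add_assoc]
      _ = _ := by rw [← hmean]; simp
  have hnonneg : 0 ≤ (1 - ε * perpMean f W y) / 2 := by
    refine nonneg_of_mul_nonneg_right (a := (Fintype.card (dotPerp W) : ℝ)) ?_ hN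
    rw [hmean]
    exact sum_nonneg fun h _ => by rcases hu (y + h) with h | h <;> simp [h]
  refine le_trans ?_ (mul_le_mul_of_nonneg_right hm' hnonneg)
  refine le_of_mul_le_mul_left ?_ hN
  linarith

end perpMean

section

variable {n : ℕ} {f : (Fin n → ZMod 2) → ℝ}

lemma mem_dotPerp_span_fSupp_of_periodic {d : Fin n → ZMod 2} (hd : ∀ x, f (x + d) = f x) :
    d ∈ dotPerp (Submodule.span (ZMod 2) (fSupp f)) := by
  have h : Submodule.span (ZMod 2) (fSupp f) ≤ dotPerp (Submodule.span (ZMod 2) {d}) := by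
    refine Submodule.span_le.2 fun S hS => ?_
    have h₁ : fCoeff f S = walsh S d * fCoeff f S := by
      conv_lhs => rw [fCoeff_eq_sum_walsh, ← Equiv.sum_comp (Equiv.addRight d)]
      simp only [Equiv.coe_addRight, hd, walsh_add_right, fCoeff_eq_sum_walsh, ← mul_assoc,
        ← sum_mul]
      ring
    have h₂ : S ⬝ᵥ d = 0 :=
      (walsh_eq_one_iff S d).1 (mul_right_cancel₀ hS (h₁.symm.trans (one_mul _).symm))
    refine (mem_dotPerp _).2 fun x hx => ?_
    obtain ⟨a, rfl⟩ := Submodule.mem_span_singleton.1 hx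
    rw [smul_dotProduct, dotProduct_comm, h₂, smul_zero]
  refine (mem_dotPerp _).2 fun S hS => ?_
  rw [dotProduct_comm]
  exact (mem_dotPerp _).1 (h hS) d (Submodule.mem_span_singleton_self d)

lemma log_card_div_le_sum_binEntropy_perpMean (hf : ∀ x, f x = 1 ∨ f x = -1)
    (W : Submodule (ZMod 2) (Fin n → ZMod 2)) {m : ℕ} (t : Fin m → Fin n → ZMod 2)
    (ht : ∀ c : fSupp f → ℝ,
      (∀ i, (fun S : fSupp f => walsh (S : Fin n → ZMod 2) (t i)) ⬝ᵥ c = 0) →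
      ∀ x, (fun S : fSupp f => walsh (S : Fin n → ZMod 2) x) ⬝ᵥ c = 0) (y : Fin n → ZMod 2) :
    Real.log (Fintype.card (dotPerp W) /
        Fintype.card (dotPerp (Submodule.span (ZMod 2) (fSupp f)))) ≤
      ∑ i, Real.binEntropy ((1 + perpMean f W (t i + y)) / 2) := by
  refine log_card_div_le_sum_binEntropy (fun (h : dotPerp W) i => f (t i + y + h))
    (fun h i => hf _) _ (fun i => card_mul_perpMean f W (t i + y)) (by simp [Fintype.card_pos])
    fun h => ?_
  rw [← card_univ]
  have hmem : ∀ h' : dotPerp W, (fun i => f (t i + y + h')) = (fun i => f (t i + y + h)) →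
      (h' - h : Fin n → ZMod 2) ∈ dotPerp (Submodule.span (ZMod 2) (fSupp f)) := fun h' hh' => by
    refine mem_dotPerp_span_fSupp_of_periodic fun x => ?_
    let c : fSupp f → ℝ := fun S => fCoeff f S *
      (walsh (S : Fin n → ZMod 2) (y + h') - walsh (S : Fin n → ZMod 2) (y + h))
    have hc : ∀ x, (fun S : fSupp f => walsh (S : Fin n → ZMod 2) x) ⬝ᵥ c =
        f (x + y + h') - f (x + y + h) := fun x => by
      rw [← sum_fSupp_mul_walsh f (x + y + h'), ← sum_fSupp_mul_walsh f (x + y + h),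
        ← sum_sub_distrib]
      refine sum_congr rfl fun S _ => ?_
      simp only [c, add_assoc, walsh_add_right]
      ring
    have hx := ht c (fun i => by rw [hc, congrFun hh' i, sub_self]) (x - y - h)
    rw [hc, sub_eq_zero] at hx
    convert hx using 2 <;> abel
  let φ : dotPerp W → dotPerp (Submodule.span (ZMod 2) (fSupp f)) := fun h' =>
    if hh' : (h' - h : Fin n → ZMod 2) ∈ dotPerp (Submodule.span (ZMod 2) (fSupp f)) then
      ⟨_, hh'⟩ else 0
  have hφ : Set.InjOn φ ({h' | (fun i => f (t i + y + h')) = fun i => f (t i + y + h)} :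
      Finset (dotPerp W)) := fun a ha b hb hab => by
    have ha' := hmem a (mem_filter.1 (mem_coe.1 ha)).2
    have hb' := hmem b (mem_filter.1 (mem_coe.1 hb)).2
    simp only [φ, dif_pos ha', dif_pos hb', Subtype.mk.injEq, sub_left_inj] at hab
    exact Subtype.ext hab
  exact_mod_cast card_le_card_of_injOn φ (fun _ _ => mem_univ _) hφ

end

/-- For a `k`-Fourier-sparse `f : 𝔽₂ⁿ → {−1,1}` with Fourier span `𝒱` and Fourier
dimension `r`: for every `r' ≥ 0` and `𝒮 ⊆ 𝒱` with `dim(span(𝒮)) = r'`, the Fourier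
weight of `f` on `span(𝒮)` is at most `1 − (r − r')/(k·log₂ k)`. -/
theorem fourier_weight_span_bound {n k : ℕ} (hn : 1 ≤ n) (hk : 2 ≤ k)
    (f : (Fin n → ZMod 2) → ℝ) (hf : ∀ x, f x = 1 ∨ f x = -1)
    (hsparse : (fSupp f).ncard ≤ k)
    (r r' : ℕ)
    (hr : Module.finrank (ZMod 2) (Submodule.span (ZMod 2) (fSupp f)) = r)
    (𝒮 : Set (Fin n → ZMod 2))
    (h𝒮 : 𝒮 ⊆ ↑(Submodule.span (ZMod 2) (fSupp f)))
    (hr' : Module.finrank (ZMod 2) (Submodule.span (ZMod 2) 𝒮) = r') :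
    ∑ S : Fin n → ZMod 2,
        (if S ∈ Submodule.span (ZMod 2) 𝒮 then (fCoeff f S) ^ 2 else 0)
      ≤ 1 - ((r : ℝ) - r') / (k * Real.logb 2 k) := by
  set V := Submodule.span (ZMod 2) (fSupp f)
  set W := Submodule.span (ZMod 2) 𝒮
  have hk' : (2 : ℝ) ≤ k := by exact_mod_cast hk
  have hlog2 : 0 < Real.log 2 := Real.log_pos (by norm_num)
  have hlogk : 0 < Real.log k := Real.log_pos (by linarith)
  obtain ⟨m, t, hm, ht⟩ := exists_interpolation
    fun (x : Fin n → ZMod 2) (S : fSupp f) => walsh (S : Fin n → ZMod 2) x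
  have hm' : (m : ℝ) ≤ k := by
    rw [← Nat.card_eq_fintype_card, Nat.card_coe_set_eq] at hm
    exact_mod_cast hm.trans hsparse
  have hcard : Real.log (Fintype.card (dotPerp W) / Fintype.card (dotPerp V)) =
      ((r : ℝ) - r') * Real.log 2 := by
    have hWc := card_dotPerp W
    have hVc := card_dotPerp V
    rw [hr'] at hWc
    rw [hr] at hVc
    rw [eq_div_of_mul_eq (by positivity) hWc, eq_div_of_mul_eq (by positivity) hVc,
      div_div_div_cancel_left' _ _ (by positivity), Real.log_div (by positivity) (by positivity),
      Real.log_pow, Real.log_pow]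
    ring
  have hent : ∀ y, 0 ≤ (1 - perpMean f W y ^ 2) * Real.log k ∧
      Real.binEntropy ((1 + perpMean f W y) / 2) ≤
        (1 - perpMean f W y ^ 2) * Real.log k := fun y => by
    have h₁ := perpMean_granular W hf hk hsparse y (.inl rfl)
    have h₂ := perpMean_granular W hf hk hsparse y (.inr rfl)
    rw [show (1 - -1 * perpMean f W y) / 2 = (1 + perpMean f W y) / 2 by ring] at h₂
    rw [show (1 - 1 * perpMean f W y) / 2 = 1 - (1 + perpMean f W y) / 2 by ring] at h₁
    have hle := (binEntropy_le hk' h₂ h₁).trans_eq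
      (show _ = (1 - perpMean f W y ^ 2) * Real.log k by ring)
    have hpos : ∀ {p : ℝ}, p = 0 ∨ 1 ≤ k * p → 0 ≤ p := fun {p} hp =>
      hp.elim ge_of_eq fun h =>
        nonneg_of_mul_nonneg_right (zero_le_one.trans h) (zero_lt_two.trans_le hk')
    exact ⟨(Real.binEntropy_nonneg (hpos h₂) (sub_nonneg.1 (hpos h₁))).trans hle, hle⟩
  set weight := ∑ S, (if S ∈ W then fCoeff f S ^ 2 else 0)
  have htotal : ∑ y, (1 - perpMean f W y ^ 2) * Real.log k =
      2 ^ n * ((1 - weight) * Real.log k) := by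
    rw [← sum_mul, sum_sub_distrib, sum_perpMean_sq]
    simp
    ring
  have hshift : ∑ y, ∑ i, Real.binEntropy ((1 + perpMean f W (t i + y)) / 2) ≤
      m * (2 ^ n * ((1 - weight) * Real.log k)) := by
    rw [sum_comm, ← htotal]
    calc _ ≤ ∑ _i : Fin m, ∑ y, (1 - perpMean f W y ^ 2) * Real.log k := by
          refine sum_le_sum fun i _ => ?_
          rw [← Equiv.sum_comp (Equiv.addLeft (t i)) fun y =>
            (1 - perpMean f W y ^ 2) * Real.log k]
          exact sum_le_sum fun y _ => (hent _).2
      _ = _ := by simp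
  have hmain : 2 ^ n * (((r : ℝ) - r') * Real.log 2) ≤
      m * (2 ^ n * ((1 - weight) * Real.log k)) := by
    refine le_trans ?_ hshift
    rw [← hcard]
    calc _ = ∑ _y : Fin n → ZMod 2,
          Real.log (Fintype.card (dotPerp W) / Fintype.card (dotPerp V)) := by simp
      _ ≤ _ := sum_le_sum fun y _ => log_card_div_le_sum_binEntropy_perpMean hf W t ht y
  have hnonneg : 0 ≤ 2 ^ n * ((1 - weight) * Real.log k) := by
    rw [← htotal]
    exact sum_nonneg fun y _ => (hent y).1
  have h₁ : 2 ^ n * (((r : ℝ) - r') * Real.log 2) ≤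
      2 ^ n * ((1 - weight) * (k * Real.log k)) :=
    (hmain.trans (mul_le_mul_of_nonneg_right hm' hnonneg)).trans_eq (by ring)
  have h₂ := le_of_mul_le_mul_left h₁ (by positivity)
  have h₃ : ((r : ℝ) - r') / (k * Real.logb 2 k) ≤ 1 - weight := by
    rw [Real.logb, div_le_iff₀ (by positivity)]
    calc (r : ℝ) - r' = ((r : ℝ) - r') * Real.log 2 / Real.log 2 := by field_simp
      _ ≤ (1 - weight) * (k * Real.log k) / Real.log 2 := by gcongr
      _ = _ := by ring
  linarith
end
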